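/- arXiv:1207.1019 — 2 statements merged into one kernel-verified Lean document; each statement's English description precedes it below -/
import Mathlib

section
/- (C-Bound) Let X be a measurable space, Y = {−1, 1}, and D a probability measure on X × Y. Let h_1, …, h_N : X → ℝ be bounded measurable functions and q_1, …, q_N ≥ 0 weights with Σ_{i=1}^N q_i = 1; set H_Q(x) = Σ_{i=1}^N q_i h_i(x) and B_Q(x) = sign(H_Q(x)), where sign(a) = 1 if a ≥ 0 and −1 otherwise. If E_{(x,y)∼D}[y·H_Q(x)] > 0, then R_D(B_Q) ≤ C_Q^D, where R_D(B_Q) = P_{(x,y)∼D}(B_Q(x) ≠ y) and C_Q^D = Var_{(x,y)∼D}(y·H_Q(x))/E_{(x,y)∼D}[(y·H_Q(x))²] = 1 − (M_Q^D)²/M_{Q²}^D, with first moment M_Q^D = E_{(x,y)∼D}[y·H_Q(x)] and second moment M_{Q²}^D = E_{(x,y)∼D}[(y·H_Q(x))²] of the Q-margin y·H_Q(x). -/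
open MeasureTheory

/-- One-sided Chebyshev inequality, in terms of the first two moments: a random variable with
positive mean is nonpositive with probability at most `1 - (E f)² / E f²`. -/
theorem measureReal_nonpos_le_one_sub_sq_integral_div {Ω : Type*} [MeasurableSpace Ω]
    {μ : Measure Ω} [IsProbabilityMeasure μ] {f : Ω → ℝ} (hf : MemLp f 2 μ)
    (hpos : 0 < ∫ ω, f ω ∂μ) :
    0 < ∫ ω, f ω ^ 2 ∂μ ∧
      μ.real {ω | f ω ≤ 0} ≤ 1 - (∫ ω, f ω ∂μ) ^ 2 / ∫ ω, f ω ^ 2 ∂μ := by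
  have hf1 : Integrable f μ := hf.integrable one_le_two
  have hf2 : Integrable (fun ω => f ω ^ 2) μ := hf.integrable_sq
  have hexpand (c : ℝ) : (fun ω => (1 - c * f ω) ^ 2) =
      fun ω => 1 - 2 * c * f ω + c ^ 2 * f ω ^ 2 := by
    funext ω
    ring
  have hlin (c : ℝ) : Integrable (fun ω => 1 - 2 * c * f ω) μ :=
    (integrable_const 1).sub (hf1.const_mul _)
  have hint (c : ℝ) : Integrable (fun ω => (1 - c * f ω) ^ 2) μ := by
    rw [hexpand]
    exact (hlin c).add (hf2.const_mul _)
  have hval (c : ℝ) : ∫ ω, (1 - c * f ω) ^ 2 ∂μ =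
      1 - 2 * c * (∫ ω, f ω ∂μ) + c ^ 2 * ∫ ω, f ω ^ 2 ∂μ := by
    rw [hexpand, integral_add (hlin c) (hf2.const_mul _),
      integral_sub (integrable_const 1) (hf1.const_mul _), integral_const_mul, integral_const_mul]
    simp
  have hsq : 0 < ∫ ω, f ω ^ 2 ∂μ := by
    refine (integral_nonneg fun ω => sq_nonneg (f ω)).lt_of_ne' fun hzero => ?_
    have hnonneg : 0 ≤ ∫ ω, (1 - (∫ ω, f ω ∂μ)⁻¹ * f ω) ^ 2 ∂μ :=
      integral_nonneg fun ω => sq_nonneg _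
    rw [hval, hzero, mul_assoc, inv_mul_cancel₀ hpos.ne'] at hnonneg
    linarith
  refine ⟨hsq, ?_⟩
  set c := (∫ ω, f ω ∂μ) / ∫ ω, f ω ^ 2 ∂μ with hc
  have hc0 : 0 < c := div_pos hpos hsq
  have hmarkov := mul_meas_ge_le_integral_of_nonneg
    (ae_of_all μ fun ω => sq_nonneg (1 - c * f ω)) (hint c) 1
  rw [one_mul, hval] at hmarkov
  calc μ.real {ω | f ω ≤ 0} ≤ μ.real {ω | 1 ≤ (1 - c * f ω) ^ 2} := by
        refine measureReal_mono fun ω (hω : f ω ≤ 0) => ?_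
        change 1 ≤ (1 - c * f ω) ^ 2
        nlinarith [mul_nonpos_of_nonneg_of_nonpos hc0.le hω]
    _ ≤ 1 - 2 * c * (∫ ω, f ω ∂μ) + c ^ 2 * ∫ ω, f ω ^ 2 ∂μ := hmarkov
    _ = 1 - (∫ ω, f ω ∂μ) ^ 2 / ∫ ω, f ω ^ 2 ∂μ := by
        rw [hc]
        field_simp
        ring

/-- The C-Bound of Laviolette et al.: if the first moment of the Q-margin is
positive, the risk of the Q-weighted majority vote `B_Q = sign ∘ H_Q` is at
most `C_Q^D = Var(y·H_Q(x)) / E[(y·H_Q(x))²] = 1 − (M_Q^D)²/M_{Q²}^D`. -/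
theorem c_bound
    {X : Type*} [MeasurableSpace X] (D : Measure (X × ℝ)) [IsProbabilityMeasure D]
    (hlabel : ∀ᵐ p ∂D, p.2 = 1 ∨ p.2 = -1)
    (N : ℕ) (h : ℕ → X → ℝ) (hmeas : ∀ i, Measurable (h i))
    (hbdd : ∀ i, ∃ C : ℝ, ∀ x, |h i x| ≤ C)
    (q : ℕ → ℝ) (hq : ∀ i, 0 ≤ q i) (hsum : ∑ i ∈ Finset.range N, q i = 1)
    (HQ : X → ℝ) (hHQ : ∀ x, HQ x = ∑ i ∈ Finset.range N, q i * h i x)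
    (BQ : X → ℝ) (hBQ : ∀ x, BQ x = if 0 ≤ HQ x then 1 else -1)
    (M1 M2 : ℝ)
    (hM1 : M1 = ∫ p, p.2 * HQ p.1 ∂D)
    (hM2 : M2 = ∫ p, (p.2 * HQ p.1) ^ 2 ∂D)
    (hM1pos : 0 < M1) :
    (D {p | BQ p.1 ≠ p.2}).toReal ≤ (M2 - M1 ^ 2) / M2 ∧
      (M2 - M1 ^ 2) / M2 = 1 - M1 ^ 2 / M2 := by
  have hHQmeas : Measurable HQ := by
    rw [funext hHQ]
    fun_prop
  choose C hC using hbdd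
  have hHQbdd (x : X) : |HQ x| ≤ ∑ i ∈ Finset.range N, q i * C i := by
    rw [hHQ]
    refine (Finset.abs_sum_le_sum_abs _ _).trans (Finset.sum_le_sum fun i _ => ?_)
    rw [abs_mul, abs_of_nonneg (hq i)]
    exact mul_le_mul_of_nonneg_left (hC i x) (hq i)
  have hmargin : MemLp (fun p : X × ℝ => p.2 * HQ p.1) 2 D := by
    refine MemLp.of_bound (by fun_prop) (∑ i ∈ Finset.range N, q i * C i) ?_
    filter_upwards [hlabel] with p hp
    rcases hp with hp | hp <;> simpa [hp] using hHQbdd p.1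
  obtain ⟨hM2pos, hbound⟩ :=
    measureReal_nonpos_le_one_sub_sq_integral_div hmargin (hM1 ▸ hM1pos)
  rw [← hM2] at hM2pos
  rw [← hM1, ← hM2] at hbound
  have heq : (M2 - M1 ^ 2) / M2 = 1 - M1 ^ 2 / M2 := by
    rw [sub_div, div_self hM2pos.ne']
  refine ⟨?_, heq⟩
  rw [heq]
  refine le_trans (ENNReal.toReal_mono (measure_ne_top _ _) (measure_mono_ae ?_)) hbound
  filter_upwards [hlabel] with p hp (herr : BQ p.1 ≠ p.2)
  change p.2 * HQ p.1 ≤ 0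
  rw [hBQ] at herr
  split_ifs at herr with hsign <;> rcases hp with hp | hp <;> simp_all
  linarith
end

section
/- Let H = {h_1, …, h_{2n}} be an auto-complemented family of real-valued functions on a set X, i.e. h_{i+n}(x) = −h_i(x) for all x ∈ X and all i ∈ {1, …, n}, with n ≥ 1, and let q_1, …, q_{2n} ≥ 0 be any weights with Σ_{i=1}^{2n} q_i = 1. Then there exist weights q'_1, …, q'_{2n} ≥ 0 that are quasi-uniform, i.e. q'_i + q'_{i+n} = 1/n for all i ∈ {1, …, n}, and a constant c > 0 such that Σ_{i=1}^{2n} q'_i h_i(x) = c · Σ_{i=1}^{2n} q_i h_i(x) for all x ∈ X. In particular, the quasi-uniform weights induce the same majority vote sign(H_{Q'}(x)) = sign(H_Q(x)) wherever H_Q(x) ≠ 0. -/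
/-- A weighted sum over an auto-complemented family only depends on the differences of the
weights of complementary members. -/
theorem sum_mul_of_auto_complemented (n : ℕ) (g : ℕ → ℝ)
    (hg : ∀ i ∈ Finset.range n, g (i + n) = - g i) (w : ℕ → ℝ) :
    ∑ i ∈ Finset.range (2 * n), w i * g i =
      ∑ i ∈ Finset.range n, (w i - w (i + n)) * g i := by
  rw [two_mul, Finset.sum_range_add, ← Finset.sum_add_distrib]
  refine Finset.sum_congr rfl fun i hi => ?_
  rw [add_comm n i, hg i hi]
  ring

/-- Every distribution over an auto-complemented family of voters can be
represented by a quasi-uniform one: there are quasi-uniform weights `q'` and a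
constant `c > 0` with `H_{Q'} = c · H_Q`; in particular the two majority votes
agree wherever `H_Q(x) ≠ 0`. -/
theorem quasi_uniform_representation
    {X : Type*} (n : ℕ) (hn : 1 ≤ n) (h : ℕ → X → ℝ)
    (hac : ∀ i ∈ Finset.range n, ∀ x : X, h (i + n) x = - h i x)
    (q : ℕ → ℝ) (hq : ∀ i ∈ Finset.range (2 * n), 0 ≤ q i)
    (hsum : ∑ i ∈ Finset.range (2 * n), q i = 1) :
    ∃ q' : ℕ → ℝ,
      (∀ i ∈ Finset.range (2 * n), 0 ≤ q' i) ∧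
      (∀ i ∈ Finset.range n, q' i + q' (i + n) = 1 / n) ∧
      ∃ c : ℝ, 0 < c ∧
        (∀ x : X, ∑ i ∈ Finset.range (2 * n), q' i * h i x =
            c * ∑ i ∈ Finset.range (2 * n), q i * h i x) ∧
        (∀ x : X, (∑ i ∈ Finset.range (2 * n), q i * h i x) ≠ 0 →
          (if 0 ≤ ∑ i ∈ Finset.range (2 * n), q' i * h i x then (1 : ℝ) else -1) =
          (if 0 ≤ ∑ i ∈ Finset.range (2 * n), q i * h i x then (1 : ℝ) else -1)) := by
  have hn0 : (0 : ℝ) < n := by exact_mod_cast hn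
  have hle : ∀ i ∈ Finset.range (2 * n), q i ≤ 1 := fun i hi =>
    hsum ▸ Finset.single_le_sum hq hi
  let q' : ℕ → ℝ := fun i =>
    (1 + (q i - q (if i < n then i + n else i - n))) / (2 * n)
  have hlow : ∀ i ∈ Finset.range n, q' i = (1 + (q i - q (i + n))) / (2 * n) := by
    intro i hi
    simp [q', Finset.mem_range.mp hi]
  have hhigh : ∀ i, q' (i + n) = (1 + (q (i + n) - q i)) / (2 * n) := by
    intro i
    simp [q']
  have hscore : ∀ x : X, ∑ i ∈ Finset.range (2 * n), q' i * h i x =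
      1 / n * ∑ i ∈ Finset.range (2 * n), q i * h i x := by
    intro x
    rw [sum_mul_of_auto_complemented n (h · x) (fun i hi => hac i hi x),
      sum_mul_of_auto_complemented n (h · x) (fun i hi => hac i hi x), Finset.mul_sum]
    refine Finset.sum_congr rfl fun i hi => ?_
    rw [hlow i hi, hhigh i]
    field_simp
    ring
  refine ⟨q', fun i hi => ?_, fun i hi => ?_, 1 / n, by positivity, hscore, fun x _ => ?_⟩
  · have hmem : (if i < n then i + n else i - n) ∈ Finset.range (2 * n) := by
      rw [Finset.mem_range] at hi ⊢
      split_ifs <;> omega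
    have h₁ := hq i hi
    have h₂ := hle _ hmem
    exact div_nonneg (by linarith) (by positivity)
  · rw [hlow i hi, hhigh i]
    field_simp
    ring
  · simp only [hscore x, mul_nonneg_iff_of_pos_left (one_div_pos.mpr hn0)]
end
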